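/- Let G be a strongly balanced connected graph with v(G) ≥ 2 vertices and e(G) edges. If p_n ≪ n^{−(v(G)−1)/e(G)}, i.e. n·p_n^{e(G)/(v(G)−1)} → 0, then there exists n₀ such that for all n ≥ n₀ and all j ≥ 2, |κ_j(N_G)| ≤ j^{j−1} (j!)^{v(G)} (v(G)!)^{j−1} a(G)^{−j} n^{v(G)} p_n^{e(G)}. -/

import Mathlib

open MeasureTheory Finset ProbabilityTheory

/-- The joint cumulant, via the moment–cumulant formula. -/
noncomputable def jointCumulant {Ω : Type*} [MeasurableSpace Ω] (P : Measure Ω)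
    {j : ℕ} (Z : Fin j → Ω → ℝ) : ℝ :=
  ∑ σ : Finpartition (Finset.univ : Finset (Fin j)),
    (-1 : ℝ) ^ (σ.parts.card - 1) * ((σ.parts.card - 1).factorial : ℝ) *
      ∏ b ∈ σ.parts, ∫ ω, ∏ i ∈ b, Z i ω ∂P

/-- The `j`-th cumulant `κ_j(W)` of a random variable `W`. -/
noncomputable def cum {Ω : Type*} [MeasurableSpace Ω] (P : Measure Ω)
    (j : ℕ) (W : Ω → ℝ) : ℝ :=
  jointCumulant P (fun _ : Fin j => W)

/-- The size `a(G)` of the automorphism group of `G`. -/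
noncomputable def autCard {k : ℕ} (G : SimpleGraph (Fin k)) : ℕ := Nat.card (G ≃g G)

/-- The injective subgraph count `N_G` in the binomial random-connection model:
vertices `X_1,…,X_n`, and `X_i ∼ X_j` iff `Y_{i,j} ≤ p_n H(X_i,X_j)` where the
`Y_{i,j}` are i.i.d. uniform on `[0,1]`. -/
noncomputable def NG {d k n : ℕ} {Ω : Type*} (G : SimpleGraph (Fin k)) [DecidableRel G.Adj]
    (H : (Fin d → ℝ) → (Fin d → ℝ) → ℝ) (pn : ℝ) (aG : ℕ)
    (X : Fin n → Ω → (Fin d → ℝ)) (Y : Fin n → Fin n → Ω → ℝ) (ω : Ω) : ℝ :=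
  (aG : ℝ)⁻¹ * ∑ β ∈ (Finset.univ : Finset (Fin k → Fin n)).filter Function.Injective,
    ∏ q ∈ (Finset.univ : Finset (Fin k × Fin k)).filter (fun q => q.1 < q.2 ∧ G.Adj q.1 q.2),
      if Y (β q.1) (β q.2) ω ≤ pn * H (X (β q.1) ω) (X (β q.2) ω) then (1 : ℝ) else 0

/-- The projection `f_{(ℓ)}` of the subgraph-count functional:
`f_{(ℓ)}(x) = (p^{e(G)}/a(G)) ∫ ∏_{(ı,ȷ)∈E_G} H(x_ı,x_ȷ) dμ^{⊗(k−1)}` with `x_ℓ = x`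
(the unused `ℓ`-th coordinate is also integrated out, which is harmless since `μ` is a
probability measure). -/
noncomputable def fSub {d k : ℕ} (G : SimpleGraph (Fin k)) [DecidableRel G.Adj]
    (H : (Fin d → ℝ) → (Fin d → ℝ) → ℝ) (μ : Measure (Fin d → ℝ)) (pn : ℝ) (aG : ℕ)
    (ℓ : Fin k) (x : Fin d → ℝ) : ℝ :=
  (pn ^ G.edgeFinset.card / (aG : ℝ)) *
    ∫ z : Fin k → (Fin d → ℝ),
      ∏ q ∈ (Finset.univ : Finset (Fin k × Fin k)).filter
          (fun q => q.1 < q.2 ∧ G.Adj q.1 q.2),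
        H (Function.update z ℓ x q.1) (Function.update z ℓ x q.2)
      ∂(Measure.pi fun _ => μ)

/-- A graph `G` is strongly balanced if `e(H)/(v(H)−1) ≤ e(G)/(v(G)−1)` for every
subgraph `H` of `G` with at least two vertices. -/
def StronglyBalanced {k : ℕ} (G : SimpleGraph (Fin k)) [DecidableRel G.Adj] : Prop :=
  ∀ Hs : G.Subgraph, 2 ≤ Hs.verts.ncard →
    Hs.edgeSet.ncard * (k - 1) ≤ G.edgeFinset.card * (Hs.verts.ncard - 1)

section Partitions

open Polynomial

variable {α : Type*} [Fintype α] [DecidableEq α]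

/-- The partition of a finite type into the nonempty fibres of a function. -/
def fiberPartition {x : ℕ} (f : α → Fin x) : Finpartition (univ : Finset α) :=
  haveI : DecidableRel (Setoid.ker f) := fun a b => decEq (f a) (f b)
  Finpartition.ofSetoid (Setoid.ker f)

lemma mem_part_fiberPartition {x : ℕ} (f : α → Fin x) (a b : α) :
    b ∈ (fiberPartition f).part a ↔ f a = f b := by
  let _ : DecidableRel (Setoid.ker f) := fun a b => decEq (f a) (f b)
  exact Finpartition.mem_part_ofSetoid_iff_rel (s := Setoid.ker f)

lemma part_fiberPartition {x : ℕ} (f : α → Fin x) (a : α) :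
    (fiberPartition f).part a = univ.filter (fun b => f b = f a) := by
  ext b
  simp [mem_part_fiberPartition, eq_comm]

lemma parts_eq_image_part (σ : Finpartition (univ : Finset α)) :
    σ.parts = univ.image σ.part := by
  ext b
  simp only [mem_image, mem_univ, true_and]
  constructor
  · intro hb
    obtain ⟨a, ha⟩ := σ.nonempty_of_mem_parts hb
    exact ⟨a, (σ.part_eq_iff_mem hb).2 ha⟩
  · rintro ⟨a, rfl⟩
    exact σ.part_mem.2 (mem_univ a)

lemma fiberPartition_eq_iff {x : ℕ} (f : α → Fin x) (σ : Finpartition (univ : Finset α)) :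
    fiberPartition f = σ ↔ ∀ a b, f a = f b ↔ σ.part a = σ.part b := by
  have key : ∀ a b, b ∈ σ.part a ↔ σ.part a = σ.part b := fun a b => by
    rw [σ.mem_part_iff_part_eq_part (mem_univ b) (mem_univ a)]
    exact eq_comm
  constructor
  · rintro rfl a b
    rw [← key, mem_part_fiberPartition]
  · intro h
    apply Finpartition.ext
    rw [parts_eq_image_part, parts_eq_image_part]
    congr 1
    ext a b
    rw [mem_part_fiberPartition, h, key]

lemma prod_fiber_eq {M : Finset α → ℝ} (hM : M ∅ = 1) {x : ℕ} (f : α → Fin x) :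
    ∏ c, M (univ.filter fun a => f a = c) = ∏ b ∈ (fiberPartition f).parts, M b := by
  have h1 : ∏ c, M (univ.filter fun a => f a = c)
      = ∏ c ∈ univ.image f, M (univ.filter fun a => f a = c) := by
    symm
    apply prod_subset (subset_univ _)
    intro c _ hc
    rw [filter_eq_empty_iff.2, hM]
    intro a _ hac
    exact hc (mem_image.2 ⟨a, mem_univ a, hac⟩)
  have h2 : (fiberPartition f).parts
      = (univ.image f).image fun c => univ.filter fun a => f a = c := by
    rw [parts_eq_image_part, image_image]
    congr 1
    ext a : 1
    exact part_fiberPartition f a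
  rw [h1, h2]
  refine (prod_image (f := M) ?_).symm
  intro c hc c' _ hcc
  obtain ⟨a, -, rfl⟩ := mem_image.1 (mem_coe.1 hc)
  have : a ∈ univ.filter fun b => f b = c' := by
    have hcc' : (univ.filter fun b => f b = f a) = univ.filter fun b => f b = c' := hcc
    rw [← hcc']
    simp
  simpa using this

lemma card_fiberPartition_eq (x : ℕ) (σ : Finpartition (univ : Finset α)) :
    (univ.filter fun f : α → Fin x => fiberPartition f = σ).card
      = x.descFactorial σ.parts.card := by
  have h := Fintype.card_embedding_eq (α := σ.parts) (β := Fin x)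
  rw [Fintype.card_fin, Fintype.card_coe] at h
  rw [← h, ← Finset.card_univ]
  symm
  refine Finset.card_bij
    (fun e _ a => e ⟨σ.part a, σ.part_mem.2 (mem_univ a)⟩) ?_ ?_ ?_
  · intro e _
    simp only [mem_filter, mem_univ, true_and, fiberPartition_eq_iff]
    intro a b
    simp
  · intro e _ e' _ hee
    ext ⟨b, hb⟩ : 1
    obtain ⟨a, ha⟩ := σ.nonempty_of_mem_parts hb
    have := congrFun hee a
    simpa [σ.part_eq_of_mem hb ha] using this
  · intro f hf
    simp only [mem_filter, mem_univ, true_and, fiberPartition_eq_iff] at hf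
    have hne : ∀ b : σ.parts, b.1.Nonempty := fun b => σ.nonempty_of_mem_parts b.2
    refine ⟨⟨fun b => f (hne b).choose, ?_⟩, mem_univ _, ?_⟩
    · intro b b' hbb
      have := (hf _ _).1 hbb
      rw [σ.part_eq_of_mem b.2 (hne b).choose_spec,
        σ.part_eq_of_mem b'.2 (hne b').choose_spec] at this
      exact Subtype.ext this
    · ext a : 1
      have hp := σ.part_mem.2 (mem_univ a)
      exact (hf _ _).2 (σ.part_eq_of_mem hp (hne ⟨_, hp⟩).choose_spec)

lemma sum_prod_fiber {M : Finset α → ℝ} (hM : M ∅ = 1) (x : ℕ) :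
    ∑ f : α → Fin x, ∏ c, M (univ.filter fun a => f a = c)
      = ∑ σ : Finpartition (univ : Finset α),
          (x.descFactorial σ.parts.card : ℝ) * ∏ b ∈ σ.parts, M b := by
  rw [← Finset.sum_fiberwise (s := univ) (g := fun f : α → Fin x => fiberPartition f)]
  refine sum_congr rfl fun σ _ => ?_
  rw [← card_fiberPartition_eq, ← nsmul_eq_mul]
  refine sum_eq_card_nsmul fun f hf => ?_
  rw [prod_fiber_eq hM, (mem_filter.1 hf).2]

/-- The polynomial interpolating `x ↦ ∑ f : α → Fin x, ∏ c, M (f ⁻¹ c)`. -/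
noncomputable def fiberPoly (M : Finset α → ℝ) : ℝ[X] :=
  ∑ σ : Finpartition (univ : Finset α),
    C (∏ b ∈ σ.parts, M b) * descPochhammer ℝ σ.parts.card

lemma eval_fiberPoly {M : Finset α → ℝ} (hM : M ∅ = 1) (x : ℕ) :
    (fiberPoly M).eval (x : ℝ) = ∑ f : α → Fin x, ∏ c, M (univ.filter fun a => f a = c) := by
  rw [sum_prod_fiber hM, fiberPoly, eval_finsetSum]
  refine sum_congr rfl fun σ _ => ?_
  rw [eval_mul, eval_C, descPochhammer_eval_eq_descFactorial, mul_comm]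

lemma parts_card_pos [Nonempty α] (σ : Finpartition (univ : Finset α)) : 0 < σ.parts.card := by
  rw [parts_eq_image_part, card_pos]
  exact univ_nonempty.image _

lemma coeff_zero_fiberPoly [Nonempty α] (M : Finset α → ℝ) : (fiberPoly M).coeff 0 = 0 := by
  rw [coeff_zero_eq_eval_zero, fiberPoly, eval_finsetSum]
  refine sum_eq_zero fun σ _ => ?_
  rw [eval_mul, descPochhammer_ne_zero_eval_zero _ (parts_card_pos σ).ne', mul_zero]

lemma coeff_one_descPochhammer (m : ℕ) :
    (descPochhammer ℝ (m + 1)).coeff 1 = (-1) ^ m * (m.factorial : ℝ) := by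
  induction m with
  | zero => simp
  | succ m ih =>
    rw [descPochhammer_succ_right, mul_coeff_one, ih, coeff_zero_eq_eval_zero,
      descPochhammer_ne_zero_eval_zero _ m.succ_ne_zero, Nat.factorial_succ]
    simp
    ring

lemma coeff_one_fiberPoly [Nonempty α] (M : Finset α → ℝ) :
    (fiberPoly M).coeff 1 = ∑ σ : Finpartition (univ : Finset α),
      (-1 : ℝ) ^ (σ.parts.card - 1) * ((σ.parts.card - 1).factorial : ℝ) *
        ∏ b ∈ σ.parts, M b := by
  rw [fiberPoly, finsetSum_coeff]
  refine sum_congr rfl fun σ _ => ?_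
  obtain ⟨m, hm⟩ := Nat.exists_eq_succ_of_ne_zero (parts_card_pos σ).ne'
  rw [coeff_C_mul, hm, Nat.succ_eq_add_one, coeff_one_descPochhammer, Nat.add_sub_cancel]
  ring

/-- Cumulants built from a set function that factorizes along a nontrivial splitting vanish. -/
lemma cumulant_sum_eq_zero_of_split {M : Finset α → ℝ} (hM : M ∅ = 1) (q : α → Prop)
    [DecidablePred q] (hq : ∃ a, q a) (hq' : ∃ a, ¬ q a)
    (hsplit : ∀ b, M b = M (b.filter q) * M (b.filter fun a => ¬ q a)) :
    ∑ σ : Finpartition (univ : Finset α),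
      (-1 : ℝ) ^ (σ.parts.card - 1) * ((σ.parts.card - 1).factorial : ℝ) *
        ∏ b ∈ σ.parts, M b = 0 := by
  obtain ⟨a₁, ha₁⟩ := hq
  obtain ⟨a₂, ha₂⟩ := hq'
  have : Nonempty α := ⟨a₁⟩
  have : Nonempty {a // q a} := ⟨⟨a₁, ha₁⟩⟩
  have : Nonempty {a // ¬ q a} := ⟨⟨a₂, ha₂⟩⟩
  set M₁ : Finset {a // q a} → ℝ := fun b => M (b.map (Function.Embedding.subtype _))
  set M₂ : Finset {a // ¬ q a} → ℝ := fun b => M (b.map (Function.Embedding.subtype _))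
  have hprod : fiberPoly M = fiberPoly M₁ * fiberPoly M₂ := by
    apply eq_of_infinite_eval_eq
    refine (Set.infinite_range_of_injective (Nat.cast_injective (R := ℝ))).mono ?_
    rintro _ ⟨x, rfl⟩
    simp only [Set.mem_ofPred_eq, eval_mul]
    rw [eval_fiberPoly hM, eval_fiberPoly (by simp [M₁, hM]), eval_fiberPoly (by simp [M₂, hM]),
      Finset.sum_mul_sum, ← Finset.sum_product', univ_product_univ]
    refine Fintype.sum_equiv (Equiv.piEquivPiSubtypeProd q fun _ => Fin x) _ _ fun f => ?_
    rw [← prod_mul_distrib]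
    refine prod_congr rfl fun c _ => ?_
    rw [hsplit]
    congr 2
    · ext a
      simp [Equiv.piEquivPiSubtypeProd, and_comm]
    · ext a
      simp [Equiv.piEquivPiSubtypeProd, and_comm]
  rw [← coeff_one_fiberPoly, hprod, mul_coeff_one, coeff_zero_fiberPoly, coeff_zero_fiberPoly]
  ring

lemma sum_factorial_parts_le :
    ∑ σ : Finpartition (univ : Finset α), ((σ.parts.card - 1).factorial : ℝ)
      ≤ (Fintype.card α : ℝ) ^ Fintype.card α := by
  have h := sum_prod_fiber (α := α) (M := fun _ => 1) rfl (Fintype.card α)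
  simp only [prod_const_one, sum_const, Finset.card_univ, Fintype.card_pi, Fintype.card_fin,
    prod_const, nsmul_eq_mul, mul_one, Nat.cast_pow] at h
  rw [h]
  refine sum_le_sum fun σ _ => ?_
  have h1 : σ.parts.card ≤ Fintype.card α := σ.card_parts_le_card
  rw [Nat.descFactorial_eq_factorial_mul_choose]
  exact_mod_cast (Nat.factorial_le (Nat.sub_le _ 1)).trans
    (Nat.le_mul_of_pos_right _ (Nat.choose_pos h1))

end Partitions

section EdgeMoments

variable {d n : ℕ}

/-- The ordered pairs of distinct vertices, one for each potential edge. -/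
abbrev OrdPair (n : ℕ) : Type := {q : Fin n × Fin n // q.1 < q.2}

/-- The joint presence indicator of the edges in `F`, as a function of positions and marks. -/
noncomputable def edgeFun (H : (Fin d → ℝ) → (Fin d → ℝ) → ℝ) (c : ℝ) (F : Finset (OrdPair n))
    (z : (Fin n → Fin d → ℝ) × (OrdPair n → ℝ)) : ℝ :=
  ∏ q ∈ F, if z.2 q ≤ c * H (z.1 q.1.1) (z.1 q.1.2) then (1 : ℝ) else 0

lemma measurable_conn {H : (Fin d → ℝ) → (Fin d → ℝ) → ℝ}
    (hHm : Measurable fun z : (Fin d → ℝ) × (Fin d → ℝ) => H z.1 z.2) (a b : Fin n) :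
    Measurable fun x : Fin n → Fin d → ℝ => H (x a) (x b) :=
  hHm.comp (f := fun x : Fin n → Fin d → ℝ => (x a, x b))
    ((measurable_pi_apply a).prodMk (measurable_pi_apply b))

lemma measurable_edgeFun {H : (Fin d → ℝ) → (Fin d → ℝ) → ℝ}
    (hHm : Measurable fun z : (Fin d → ℝ) × (Fin d → ℝ) => H z.1 z.2) (c : ℝ)
    (F : Finset (OrdPair n)) : Measurable (edgeFun H c F) := by
  refine Finset.measurable_prod _ fun q _ => Measurable.ite ?_ measurable_const measurable_const
  exact measurableSet_le ((measurable_pi_apply q).comp measurable_snd)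
    (((measurable_conn hHm q.1.1 q.1.2).comp measurable_fst).const_mul c)

lemma edgeFun_mem_Icc (H : (Fin d → ℝ) → (Fin d → ℝ) → ℝ) (c : ℝ) (F : Finset (OrdPair n))
    (z : (Fin n → Fin d → ℝ) × (OrdPair n → ℝ)) : edgeFun H c F z ∈ Set.Icc (0 : ℝ) 1 :=
  ⟨prod_nonneg fun q _ => by split_ifs <;> norm_num,
    prod_le_one (fun q _ => by split_ifs <;> norm_num) fun q _ => by split_ifs <;> norm_num⟩

instance isProbabilityMeasure_unitInterval :
    IsProbabilityMeasure ((volume : Measure ℝ).restrict (Set.Icc (0 : ℝ) 1)) :=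
  ⟨by simp⟩

lemma integral_indicator_le {c : ℝ} (hc : c ∈ Set.Icc (0 : ℝ) 1) :
    ∫ y in Set.Icc (0 : ℝ) 1, (if y ≤ c then (1 : ℝ) else 0) = c := by
  have h : (fun y : ℝ => if y ≤ c then (1 : ℝ) else 0) = (Set.Iic c).indicator fun _ => 1 := by
    ext y
    simp [Set.indicator]
  have h2 : Set.Iic c ∩ Set.Icc 0 1 = Set.Icc 0 c := by
    ext y
    simp only [Set.mem_inter_iff, Set.mem_Iic, Set.mem_Icc]
    exact ⟨fun h => ⟨h.2.1, h.1⟩, fun h => ⟨h.2, h.1, h.2.trans hc.2⟩⟩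
  rw [h, integral_indicator measurableSet_Iic, Measure.restrict_restrict measurableSet_Iic, h2]
  simp [hc.1]

/-- The probability, up to the factor `c ^ F.card`, that all the edges in `F` are present. -/
noncomputable def posMoment (μ : Measure (Fin d → ℝ)) (H : (Fin d → ℝ) → (Fin d → ℝ) → ℝ)
    (F : Finset (OrdPair n)) : ℝ :=
  ∫ x : Fin n → Fin d → ℝ, ∏ q ∈ F, H (x q.1.1) (x q.1.2) ∂(Measure.pi fun _ => μ)

variable {μ : Measure (Fin d → ℝ)} [IsProbabilityMeasure μ]
  {H : (Fin d → ℝ) → (Fin d → ℝ) → ℝ}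

lemma integral_edgeFun
    (hHm : Measurable fun z : (Fin d → ℝ) × (Fin d → ℝ) => H z.1 z.2)
    (hH01 : ∀ x y, H x y ∈ Set.Icc (0 : ℝ) 1) {c : ℝ} (hc : c ∈ Set.Icc (0 : ℝ) 1)
    (F : Finset (OrdPair n)) :
    ∫ z, edgeFun H c F z ∂((Measure.pi fun _ => μ).prod
        (Measure.pi fun _ => volume.restrict (Set.Icc (0 : ℝ) 1)))
      = c ^ F.card * posMoment μ H F := by
  have hInt : Integrable (edgeFun H c F) ((Measure.pi fun _ : Fin n => μ).prod
      (Measure.pi fun _ : OrdPair n => volume.restrict (Set.Icc (0 : ℝ) 1))) := by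
    refine Integrable.of_bound (measurable_edgeFun hHm c F).aestronglyMeasurable 1 ?_
    filter_upwards with z
    have := edgeFun_mem_Icc H c F z
    rw [Real.norm_eq_abs, abs_of_nonneg this.1]
    exact this.2
  rw [integral_prod _ hInt, posMoment, ← integral_const_mul]
  refine integral_congr_ae (Filter.Eventually.of_forall fun x => ?_)
  let g : OrdPair n → ℝ → ℝ := fun q t => if q ∈ F then
    (if t ≤ c * H (x q.1.1) (x q.1.2) then (1 : ℝ) else 0) else 1
  have h1 : (fun y : OrdPair n → ℝ => edgeFun H c F (x, y)) = fun y => ∏ q, g q (y q) := by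
    ext y
    rw [edgeFun, ← Finset.prod_subset (subset_univ F)]
    · exact prod_congr rfl fun q hq => by simp [g, hq]
    · intro q _ hq
      simp [g, hq]
  simp only [h1]
  rw [integral_fintype_prod_eq_prod, ← Finset.prod_subset (subset_univ F), ← prod_const,
    ← prod_mul_distrib]
  · refine prod_congr rfl fun q hq => ?_
    simp only [g, hq, if_true]
    have hh := hH01 (x q.1.1) (x q.1.2)
    exact integral_indicator_le ⟨mul_nonneg hc.1 hh.1, mul_le_one₀ hc.2 hh.1 hh.2⟩
  · intro q _ hq
    simp [g, hq]

lemma posMoment_mem_Icc (hH01 : ∀ x y, H x y ∈ Set.Icc (0 : ℝ) 1) (F : Finset (OrdPair n)) :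
    posMoment μ H F ∈ Set.Icc (0 : ℝ) 1 := by
  refine ⟨integral_nonneg fun x => prod_nonneg fun q _ => (hH01 _ _).1, ?_⟩
  have h := norm_integral_le_of_norm_le_const (μ := Measure.pi fun _ : Fin n => μ) (C := 1)
    (f := fun x : Fin n → Fin d → ℝ => ∏ q ∈ F, H (x q.1.1) (x q.1.2))
    (Filter.Eventually.of_forall fun x => by
      rw [Real.norm_eq_abs, abs_of_nonneg (prod_nonneg fun q _ => (hH01 _ _).1)]
      exact prod_le_one (fun q _ => (hH01 _ _).1) fun q _ => (hH01 _ _).2)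
  rw [Real.norm_eq_abs, probReal_univ, mul_one] at h
  exact (le_abs_self _).trans h

lemma posMoment_union
    (hHm : Measurable fun z : (Fin d → ℝ) × (Fin d → ℝ) => H z.1 z.2)
    {V₁ V₂ : Finset (Fin n)} (hV : Disjoint V₁ V₂) {F₁ F₂ : Finset (OrdPair n)}
    (h₁ : ∀ q ∈ F₁, q.1.1 ∈ V₁ ∧ q.1.2 ∈ V₁) (h₂ : ∀ q ∈ F₂, q.1.1 ∈ V₂ ∧ q.1.2 ∈ V₂) :
    posMoment μ H (F₁ ∪ F₂) = posMoment μ H F₁ * posMoment μ H F₂ := by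
  have hF : Disjoint F₁ F₂ := Finset.disjoint_left.2 fun q hq hq' =>
    Finset.disjoint_left.1 hV (h₁ q hq).1 (h₂ q hq').1
  have hindep : iIndepFun (fun (i : Fin n) (x : Fin n → Fin d → ℝ) => x i)
      (Measure.pi fun _ => μ) :=
    iIndepFun_pi (X := fun _ x => x) fun _ => aemeasurable_id
  have hind := hindep.indepFun_finset V₁ V₂ hV fun i => measurable_pi_apply i
  let φ : ∀ (V : Finset (Fin n)) (F : Finset (OrdPair n)), (∀ q ∈ F, q.1.1 ∈ V ∧ q.1.2 ∈ V) →
      (V → Fin d → ℝ) → ℝ := fun V F h z =>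
    ∏ q ∈ F.attach, H (z ⟨q.1.1.1, (h q.1 q.2).1⟩) (z ⟨q.1.1.2, (h q.1 q.2).2⟩)
  have hφm : ∀ V F h, Measurable (φ V F h) := fun V F h =>
    Finset.measurable_prod _ fun q _ => hHm.comp
      (f := fun z : V → Fin d → ℝ => (z ⟨q.1.1.1, (h q.1 q.2).1⟩, z ⟨q.1.1.2, (h q.1 q.2).2⟩))
      ((measurable_pi_apply _).prodMk (measurable_pi_apply _))
  have hφ : ∀ V F h, (fun x : Fin n → Fin d → ℝ => ∏ q ∈ F, H (x q.1.1) (x q.1.2))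
      = φ V F h ∘ fun x (i : V) => x i := fun V F h => by
    ext x
    exact (Finset.prod_attach F fun q => H (x q.1.1) (x q.1.2)).symm
  have key := hind.comp (hφm V₁ F₁ h₁) (hφm V₂ F₂ h₂)
  rw [← hφ V₁ F₁ h₁, ← hφ V₂ F₂ h₂] at key
  have hm : ∀ F : Finset (OrdPair n), AEStronglyMeasurable
      (fun x : Fin n → Fin d → ℝ => ∏ q ∈ F, H (x q.1.1) (x q.1.2))
      (Measure.pi fun _ => μ) := fun F =>
    (Finset.measurable_prod F fun q _ => measurable_conn hHm q.1.1 q.1.2).aestronglyMeasurable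
  rw [posMoment, posMoment, posMoment, ← key.integral_mul_eq_mul_integral (hm _) (hm _)]
  refine integral_congr_ae (Filter.Eventually.of_forall fun x => ?_)
  exact prod_union hF

end EdgeMoments

section EdgeModel

/-- A random graph on `Fin n` with edge indicators `J`, in which any given edges are present with
probability at most `c` to the number of edges, independently for vertex-disjoint edge sets. -/
structure EdgeModel {n : ℕ} {Ω : Type*} [MeasurableSpace Ω] (P : Measure Ω) (c : ℝ)
    (J : Sym2 (Fin n) → Ω → ℝ) : Prop where
  zero_or_one : ∀ e ω, J e ω = 0 ∨ J e ω = 1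
  aestronglyMeasurable : ∀ E : Finset (Sym2 (Fin n)), (∀ e ∈ E, ¬ e.IsDiag) →
    AEStronglyMeasurable (fun ω => ∏ e ∈ E, J e ω) P
  integral_nonneg : ∀ E : Finset (Sym2 (Fin n)), 0 ≤ ∫ ω, ∏ e ∈ E, J e ω ∂P
  integral_le : ∀ E : Finset (Sym2 (Fin n)), (∀ e ∈ E, ¬ e.IsDiag) →
    ∫ ω, ∏ e ∈ E, J e ω ∂P ≤ c ^ E.card
  integral_union : ∀ V₁ V₂ : Finset (Fin n), Disjoint V₁ V₂ →
    ∀ E₁ E₂ : Finset (Sym2 (Fin n)), (∀ e ∈ E₁, ¬ e.IsDiag) → (∀ e ∈ E₂, ¬ e.IsDiag) →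
    (∀ e ∈ E₁, ∀ v ∈ e, v ∈ V₁) → (∀ e ∈ E₂, ∀ v ∈ e, v ∈ V₂) →
    ∫ ω, ∏ e ∈ E₁ ∪ E₂, J e ω ∂P = (∫ ω, ∏ e ∈ E₁, J e ω ∂P) * ∫ ω, ∏ e ∈ E₂, J e ω ∂P

variable {n : ℕ}

/-- The ordered representatives of the edges in `E`. -/
def ordPairs (E : Finset (Sym2 (Fin n))) : Finset (OrdPair n) :=
  univ.filter fun q => s(q.1.1, q.1.2) ∈ E

lemma ordPair_sym2_injective :
    Function.Injective fun q : OrdPair n => s(q.1.1, q.1.2) := by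
  rintro ⟨⟨a, b⟩, hab⟩ ⟨⟨a', b'⟩, hab'⟩ h
  simp only [Sym2.eq_iff] at h
  rcases h with ⟨rfl, rfl⟩ | ⟨rfl, rfl⟩
  · rfl
  · exact absurd hab (not_lt.2 (le_of_lt hab'))

lemma image_ordPairs {E : Finset (Sym2 (Fin n))} (hE : ∀ e ∈ E, ¬ e.IsDiag) :
    (ordPairs E).image (fun q : OrdPair n => s(q.1.1, q.1.2)) = E := by
  ext e
  simp only [ordPairs, mem_image, mem_filter, mem_univ, true_and]
  constructor
  · rintro ⟨q, hq, rfl⟩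
    exact hq
  · intro he
    induction e using Sym2.ind with
    | _ a b =>
      have hne : a ≠ b := fun h => hE _ he (Sym2.mk_isDiag_iff.2 h)
      rcases lt_or_gt_of_ne hne with h | h
      · exact ⟨⟨(a, b), h⟩, he, rfl⟩
      · exact ⟨⟨(b, a), h⟩, by rw [Sym2.eq_swap]; exact he, Sym2.eq_swap⟩

lemma card_ordPairs {E : Finset (Sym2 (Fin n))} (hE : ∀ e ∈ E, ¬ e.IsDiag) :
    (ordPairs E).card = E.card := by
  rw [← card_image_of_injective _ ordPair_sym2_injective, image_ordPairs hE]

lemma prod_ordPairs {E : Finset (Sym2 (Fin n))} (hE : ∀ e ∈ E, ¬ e.IsDiag)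
    (g : Sym2 (Fin n) → ℝ) : ∏ q ∈ ordPairs E, g s(q.1.1, q.1.2) = ∏ e ∈ E, g e := by
  conv_rhs => rw [← image_ordPairs hE]
  exact (prod_image fun a _ b _ h => ordPair_sym2_injective h).symm

lemma ordPairs_union (E₁ E₂ : Finset (Sym2 (Fin n))) :
    ordPairs (E₁ ∪ E₂) = ordPairs E₁ ∪ ordPairs E₂ := by
  ext q
  simp [ordPairs]

open scoped Classical in
/-- The indicator that an edge is present in the random-connection model. -/
noncomputable def edgeInd {d : ℕ} {Ω : Type*} (H : (Fin d → ℝ) → (Fin d → ℝ) → ℝ) (c : ℝ)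
    (X : Fin n → Ω → (Fin d → ℝ)) (Y : Fin n → Fin n → Ω → ℝ)
    (e : Sym2 (Fin n)) (ω : Ω) : ℝ :=
  if ∃ a b, s(a, b) = e ∧ Y a b ω ≤ c * H (X a ω) (X b ω) then 1 else 0

variable {d : ℕ} {Ω : Type*} {H : (Fin d → ℝ) → (Fin d → ℝ) → ℝ} {c : ℝ}
  {X : Fin n → Ω → (Fin d → ℝ)} {Y : Fin n → Fin n → Ω → ℝ}

lemma edgeInd_mk (hHsym : ∀ x y, H x y = H y x) (hYsym : ∀ a b, Y a b = Y b a)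
    (a b : Fin n) (ω : Ω) :
    edgeInd H c X Y s(a, b) ω = if Y a b ω ≤ c * H (X a ω) (X b ω) then 1 else 0 := by
  rw [edgeInd]
  refine if_congr ⟨?_, fun h => ⟨a, b, rfl, h⟩⟩ rfl rfl
  rintro ⟨a', b', he, h⟩
  rcases Sym2.eq_iff.1 he with ⟨rfl, rfl⟩ | ⟨rfl, rfl⟩
  · exact h
  · rwa [hYsym, hHsym]

lemma edgeModel_edgeInd [MeasurableSpace Ω] {P : Measure Ω} [IsProbabilityMeasure P]
    {μ : Measure (Fin d → ℝ)} [IsProbabilityMeasure μ]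
    (hHm : Measurable fun z : (Fin d → ℝ) × (Fin d → ℝ) => H z.1 z.2)
    (hHsym : ∀ x y, H x y = H y x) (hH01 : ∀ x y, H x y ∈ Set.Icc (0 : ℝ) 1)
    (hc : c ∈ Set.Icc (0 : ℝ) 1) (hYsym : ∀ a b, Y a b = Y b a)
    (hlaw : Measure.map (fun ω => ((fun i => X i ω),
        (fun q : {q : Fin n × Fin n // q.1 < q.2} => Y q.1.1 q.1.2 ω))) P
      = (Measure.pi fun _ => μ).prod
          (Measure.pi fun _ => (volume.restrict (Set.Icc (0 : ℝ) 1)))) :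
    EdgeModel P c (edgeInd H c X Y) := by
  set T : Ω → (Fin n → Fin d → ℝ) × (OrdPair n → ℝ) :=
    fun ω => ((fun i => X i ω), fun q => Y q.1.1 q.1.2 ω) with hT
  have hTm : AEMeasurable T P := by
    by_contra h
    rw [Measure.map_of_not_aemeasurable h] at hlaw
    exact IsProbabilityMeasure.ne_zero _ hlaw.symm
  have hprod : ∀ E : Finset (Sym2 (Fin n)), (∀ e ∈ E, ¬ e.IsDiag) →
      (fun ω => ∏ e ∈ E, edgeInd H c X Y e ω) = fun ω => edgeFun H c (ordPairs E) (T ω) := by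
    intro E hE
    ext ω
    rw [← prod_ordPairs hE, edgeFun]
    exact prod_congr rfl fun q _ => edgeInd_mk hHsym hYsym _ _ ω
  have hInt : ∀ E : Finset (Sym2 (Fin n)), (∀ e ∈ E, ¬ e.IsDiag) →
      ∫ ω, ∏ e ∈ E, edgeInd H c X Y e ω ∂P = c ^ E.card * posMoment μ H (ordPairs E) := by
    intro E hE
    rw [hprod E hE, ← card_ordPairs hE, ← integral_edgeFun hHm hH01 hc, ← hlaw,
      integral_map hTm (measurable_edgeFun hHm c _).aestronglyMeasurable]
  refine ⟨?_, ?_, ?_, ?_, ?_⟩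
  · intro e ω
    rw [edgeInd]
    split_ifs <;> simp
  · intro E hE
    rw [hprod E hE]
    exact ((measurable_edgeFun hHm c _).comp_aemeasurable hTm).aestronglyMeasurable
  · intro E
    refine MeasureTheory.integral_nonneg fun ω => prod_nonneg fun e _ => ?_
    rw [edgeInd]
    split_ifs <;> norm_num
  · intro E hE
    rw [hInt E hE]
    exact mul_le_of_le_one_right (pow_nonneg hc.1 _) (posMoment_mem_Icc hH01 _).2
  · intro V₁ V₂ hV E₁ E₂ h₁ h₂ hV₁ hV₂
    have hmem : ∀ (V : Finset (Fin n)) (E : Finset (Sym2 (Fin n))), (∀ e ∈ E, ∀ v ∈ e, v ∈ V) →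
        ∀ q ∈ ordPairs E, q.1.1 ∈ V ∧ q.1.2 ∈ V := fun V E hVE q hq => by
      have hq' := (mem_filter.1 hq).2
      exact ⟨hVE _ hq' _ (Sym2.mem_mk_left _ _), hVE _ hq' _ (Sym2.mem_mk_right _ _)⟩
    have hdisj : Disjoint E₁ E₂ := Finset.disjoint_left.2 fun e he he' => by
      induction e using Sym2.ind with
      | _ a b => exact Finset.disjoint_left.1 hV (hV₁ _ he _ (Sym2.mem_mk_left a b))
                  (hV₂ _ he' _ (Sym2.mem_mk_left a b))
    rw [hInt _ h₁, hInt _ h₂, hInt (E₁ ∪ E₂) fun e he => (mem_union.1 he).elim (h₁ e) (h₂ e),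
      ordPairs_union, posMoment_union hHm hV (hmem _ _ hV₁) (hmem _ _ hV₂),
      card_union_of_disjoint hdisj, pow_add]
    ring

end EdgeModel

section JointCumulant

variable {Ω : Type*} [MeasurableSpace Ω] {P : Measure Ω} {j : ℕ}

/-- Choosing an index for each point amounts to choosing the indices part by part. -/
def piPartsEquiv {I : Type*} (σ : Finpartition (univ : Finset (Fin j))) :
    (Fin j → I) ≃ ((b : σ.parts) → (b.1 → I)) where
  toFun g _ i := g i
  invFun h i := h ⟨σ.part i, σ.part_mem.2 (mem_univ i)⟩ ⟨i, σ.mem_part (mem_univ i)⟩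
  left_inv _ := rfl
  right_inv h := by
    ext ⟨b, hb⟩ ⟨i, hi⟩
    have := σ.part_eq_of_mem hb hi
    subst this
    rfl

lemma prod_integral_sum {I : Type*} [Fintype I] (z : I → Ω → ℝ)
    (hz : ∀ (g : Fin j → I) (b : Finset (Fin j)), Integrable (fun ω => ∏ i ∈ b, z (g i) ω) P)
    (σ : Finpartition (univ : Finset (Fin j))) :
    ∏ b ∈ σ.parts, ∫ ω, ∏ _i ∈ b, ∑ γ, z γ ω ∂P
      = ∑ g : Fin j → I, ∏ b ∈ σ.parts, ∫ ω, ∏ i ∈ b, z (g i) ω ∂P := by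
  classical
  have hb : ∀ b : σ.parts, ∫ ω, ∏ _i ∈ b.1, ∑ γ, z γ ω ∂P
      = ∑ h : b.1 → I, ∫ ω, ∏ i : b.1, z (h i) ω ∂P := by
    intro b
    have h1 : ∀ ω, ∏ _i ∈ b.1, ∑ γ, z γ ω = ∑ h : b.1 → I, ∏ i : b.1, z (h i) ω := fun ω => by
      rw [← Finset.prod_coe_sort b.1, Finset.prod_univ_sum, Fintype.piFinset_univ]
    simp_rw [h1]
    refine integral_finsetSum _ fun h _ => ?_
    obtain ⟨i₀, hi₀⟩ := σ.nonempty_of_mem_parts b.2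
    have := hz (fun i => if hi : i ∈ b.1 then h ⟨i, hi⟩ else h ⟨i₀, hi₀⟩) b.1
    refine this.congr (Filter.Eventually.of_forall fun ω => ?_)
    simp only
    rw [← Finset.prod_coe_sort b.1]
    exact prod_congr rfl fun i _ => by simp
  rw [← Finset.prod_coe_sort σ.parts, prod_congr rfl fun b _ => hb b, Finset.prod_univ_sum,
    Fintype.piFinset_univ]
  refine (Fintype.sum_equiv (piPartsEquiv σ) _ _ fun g => ?_).symm
  rw [← Finset.prod_coe_sort σ.parts]
  refine prod_congr rfl fun b _ => ?_
  refine integral_congr_ae (Filter.Eventually.of_forall fun ω => ?_)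
  exact (Finset.prod_coe_sort b.1 fun i => z (g i) ω).symm

lemma cum_const_mul_sum {I : Type*} [Fintype I] (a : ℝ) (z : I → Ω → ℝ)
    (hz : ∀ (g : Fin j → I) (b : Finset (Fin j)), Integrable (fun ω => ∏ i ∈ b, z (g i) ω) P) :
    cum P j (fun ω => a * ∑ γ, z γ ω)
      = a ^ j * ∑ g : Fin j → I, jointCumulant P (fun i => z (g i)) := by
  unfold cum jointCumulant
  rw [Finset.sum_comm, Finset.mul_sum]
  refine sum_congr rfl fun σ _ => ?_
  have h1 : ∏ b ∈ σ.parts, ∫ ω, ∏ _i ∈ b, a * ∑ γ, z γ ω ∂P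
      = a ^ j * ∏ b ∈ σ.parts, ∫ ω, ∏ _i ∈ b, ∑ γ, z γ ω ∂P := by
    have hj : a ^ j = ∏ b ∈ σ.parts, a ^ b.card := by
      rw [prod_pow_eq_pow_sum, σ.sum_card_parts, Finset.card_univ, Fintype.card_fin]
    rw [hj, ← prod_mul_distrib]
    refine prod_congr rfl fun b _ => ?_
    rw [← integral_const_mul]
    simp_rw [prod_mul_distrib, prod_const]
  rw [h1, prod_integral_sum z hz, ← Finset.mul_sum]
  ring

variable {n : ℕ} {c : ℝ} {J : Sym2 (Fin n) → Ω → ℝ}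

lemma EdgeModel.prod_biUnion (hJ : EdgeModel P c J) (E : Fin j → Finset (Sym2 (Fin n)))
    (b : Finset (Fin j)) (ω : Ω) :
    ∏ i ∈ b, ∏ e ∈ E i, J e ω = ∏ e ∈ b.biUnion E, J e ω := by
  have h : ∀ e, J e ω = if J e ω = 1 then 1 else 0 := fun e => by
    rcases hJ.zero_or_one e ω with h | h <;> simp [h]
  have hp : ∀ F : Finset (Sym2 (Fin n)),
      ∏ e ∈ F, J e ω = if ∀ e ∈ F, J e ω = 1 then 1 else 0 := fun F => by
    rw [prod_congr rfl fun e _ => h e, prod_ite_zero, prod_const_one]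
    split_ifs <;> rfl
  simp_rw [hp, prod_ite_zero, prod_const_one, mem_biUnion]
  refine if_congr ⟨?_, ?_⟩ rfl rfl
  · rintro h e ⟨i, hi, he⟩
    exact h i hi e he
  · intro h i hi e he
    exact h e ⟨i, hi, he⟩

lemma EdgeModel.integrable [IsFiniteMeasure P] (hJ : EdgeModel P c J)
    {E : Fin j → Finset (Sym2 (Fin n))} (hE : ∀ i, ∀ e ∈ E i, ¬ e.IsDiag) (b : Finset (Fin j)) :
    Integrable (fun ω => ∏ i ∈ b, ∏ e ∈ E i, J e ω) P := by
  simp_rw [hJ.prod_biUnion E b]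
  refine Integrable.of_bound (hJ.aestronglyMeasurable _ ?_) 1 ?_
  · intro e he
    obtain ⟨i, -, hi⟩ := mem_biUnion.1 he
    exact hE i e hi
  · filter_upwards with ω
    have h : ∀ e, 0 ≤ J e ω ∧ J e ω ≤ 1 := fun e => by
      rcases hJ.zero_or_one e ω with h | h <;> simp [h]
    rw [Real.norm_eq_abs, abs_of_nonneg (prod_nonneg fun e _ => (h e).1)]
    exact prod_le_one (fun e _ => (h e).1) fun e _ => (h e).2

lemma EdgeModel.abs_jointCumulant_le (hJ : EdgeModel P c J) (hc : c ∈ Set.Icc (0 : ℝ) 1)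
    {E : Fin j → Finset (Sym2 (Fin n))} (hE : ∀ i, ∀ e ∈ E i, ¬ e.IsDiag) :
    |jointCumulant P (fun i ω => ∏ e ∈ E i, J e ω)|
      ≤ (j : ℝ) ^ j * c ^ (univ.biUnion E).card := by
  have h := sum_factorial_parts_le (α := Fin j)
  rw [Fintype.card_fin] at h
  refine le_trans ?_ (mul_le_mul_of_nonneg_right h (pow_nonneg hc.1 _))
  rw [Finset.sum_mul, jointCumulant]
  refine (abs_sum_le_sum_abs _ _).trans (sum_le_sum fun σ _ => ?_)
  simp_rw [hJ.prod_biUnion E]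
  rw [abs_mul, abs_mul, abs_pow, abs_neg, abs_one, one_pow, one_mul, Nat.abs_cast,
    abs_of_nonneg (prod_nonneg fun b _ => hJ.integral_nonneg _)]
  refine mul_le_mul_of_nonneg_left ?_ (Nat.cast_nonneg _)
  calc ∏ b ∈ σ.parts, ∫ ω, ∏ e ∈ b.biUnion E, J e ω ∂P
      ≤ ∏ b ∈ σ.parts, c ^ (b.biUnion E).card := by
        refine prod_le_prod (fun b _ => hJ.integral_nonneg _) fun b _ => hJ.integral_le _ ?_
        intro e he
        obtain ⟨i, -, hi⟩ := mem_biUnion.1 he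
        exact hE i e hi
    _ = c ^ ∑ b ∈ σ.parts, (b.biUnion E).card := prod_pow_eq_pow_sum _ _ _
    _ ≤ c ^ (univ.biUnion E).card := by
        refine pow_le_pow_of_le_one hc.1 hc.2 ?_
        refine le_trans (card_le_card ?_) card_biUnion_le
        intro e he
        obtain ⟨i, -, hi⟩ := mem_biUnion.1 he
        exact mem_biUnion.2 ⟨σ.part i, σ.part_mem.2 (mem_univ i),
          mem_biUnion.2 ⟨i, σ.mem_part (mem_univ i), hi⟩⟩

lemma EdgeModel.jointCumulant_eq_zero [IsProbabilityMeasure P] (hJ : EdgeModel P c J)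
    {E : Fin j → Finset (Sym2 (Fin n))} (hE : ∀ i, ∀ e ∈ E i, ¬ e.IsDiag)
    {V : Fin j → Finset (Fin n)} (hV : ∀ i, ∀ e ∈ E i, ∀ v ∈ e, v ∈ V i)
    {T : Finset (Fin j)} (hT : T.Nonempty) (hT' : T ≠ univ)
    (hdisj : ∀ i ∈ T, ∀ i' ∉ T, Disjoint (V i) (V i')) :
    jointCumulant P (fun i ω => ∏ e ∈ E i, J e ω) = 0 := by
  rw [jointCumulant]
  simp_rw [hJ.prod_biUnion E]
  have hne : ∃ i, i ∉ T := by
    by_contra! h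
    exact hT' (eq_univ_iff_forall.2 h)
  refine cumulant_sum_eq_zero_of_split (M := fun b => ∫ ω, ∏ e ∈ b.biUnion E, J e ω ∂P)
    (by simp) (fun i => i ∈ T) hT hne fun b => ?_
  have hb : b.biUnion E = (b.filter fun i => i ∈ T).biUnion E
      ∪ (b.filter fun i => ¬ i ∈ T).biUnion E := by
    rw [← union_biUnion, filter_union_filter_not_eq]
  have hnd : ∀ b : Finset (Fin j), ∀ e ∈ b.biUnion E, ¬ e.IsDiag := fun b e he => by
    obtain ⟨i, -, hi⟩ := mem_biUnion.1 he
    exact hE i e hi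
  have hvert : ∀ (b : Finset (Fin j)), ∀ e ∈ b.biUnion E, ∀ v ∈ e, v ∈ b.biUnion V :=
    fun b e he v hv => by
      obtain ⟨i, hib, hi⟩ := mem_biUnion.1 he
      exact mem_biUnion.2 ⟨i, hib, hV i e hi v hv⟩
  rw [hb]
  refine hJ.integral_union _ _ ?_ _ _ (hnd _) (hnd _) (hvert _) (hvert _)
  rw [disjoint_biUnion_left]
  intro i hi
  rw [disjoint_biUnion_right]
  intro i' hi'
  exact hdisj i (mem_filter.1 hi).2 i' (mem_filter.1 hi').2

end JointCumulant

section Copies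

variable {k n : ℕ} (G : SimpleGraph (Fin k)) [DecidableRel G.Adj]

/-- The edges of the copy of `G` placed at the vertices `γ`. -/
def copyEdges (γ : Fin k ↪ Fin n) : Finset (Sym2 (Fin n)) := G.edgeFinset.image (Sym2.map γ)

/-- The vertices of a copy placed by `γ`. -/
def copyVerts (γ : Fin k ↪ Fin n) : Finset (Fin n) := univ.map γ

lemma card_copyEdges (γ : Fin k ↪ Fin n) : (copyEdges G γ).card = G.edgeFinset.card :=
  card_image_of_injective _ (Sym2.map.injective γ.injective)

lemma card_copyVerts (γ : Fin k ↪ Fin n) : (copyVerts γ).card = k := by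
  simp [copyVerts]

variable {G}

lemma not_isDiag_of_mem_copyEdges {γ : Fin k ↪ Fin n} {e : Sym2 (Fin n)}
    (he : e ∈ copyEdges G γ) : ¬ e.IsDiag := by
  obtain ⟨e', he', rfl⟩ := mem_image.1 he
  rw [Sym2.isDiag_map γ.injective]
  exact G.not_isDiag_of_mem_edgeFinset he'

lemma mem_copyVerts_of_mem_copyEdges {γ : Fin k ↪ Fin n} {e : Sym2 (Fin n)}
    (he : e ∈ copyEdges G γ) {v : Fin n} (hv : v ∈ e) : v ∈ copyVerts γ := by
  obtain ⟨e', -, rfl⟩ := mem_image.1 he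
  obtain ⟨a, -, rfl⟩ := Sym2.mem_map.1 hv
  simp [copyVerts]

lemma StronglyBalanced.card_inter_le (hbal : StronglyBalanced G) (γ : Fin k ↪ Fin n)
    {W : Finset (Fin n)} {F : Finset (Sym2 (Fin n))} (hF : ∀ e ∈ F, ∀ v ∈ e, v ∈ W)
    (hne : (W ∩ copyVerts γ).Nonempty) :
    (k - 1) * (F ∩ copyEdges G γ).card + G.edgeFinset.card
      ≤ G.edgeFinset.card * (W ∩ copyVerts γ).card := by
  classical
  set A : Finset (Fin k) := univ.filter fun a => γ a ∈ W with hA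
  set B : Finset (Sym2 (Fin k)) := G.edgeFinset.filter fun e => ∀ v ∈ e, v ∈ A with hB
  have hAcard : (W ∩ copyVerts γ).card = A.card := by
    rw [← card_map γ]
    congr 1
    ext v
    simp only [copyVerts, mem_inter, mem_map, mem_univ, true_and, hA, mem_filter]
    constructor
    · rintro ⟨hv, a, rfl⟩
      exact ⟨a, hv, rfl⟩
    · rintro ⟨a, ha, rfl⟩
      exact ⟨ha, a, rfl⟩
  have hBcard : (F ∩ copyEdges G γ).card ≤ B.card := by
    refine (card_le_card (t := B.image (Sym2.map γ)) ?_).trans card_image_le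
    intro e he
    obtain ⟨heF, heG⟩ := mem_inter.1 he
    obtain ⟨e', he', rfl⟩ := mem_image.1 heG
    refine mem_image.2 ⟨e', mem_filter.2 ⟨he', fun v hv => ?_⟩, rfl⟩
    exact mem_filter.2 ⟨mem_univ v, hF _ heF _ (Sym2.mem_map.2 ⟨v, hv, rfl⟩)⟩
  have hApos : 0 < A.card := by
    rw [← hAcard]
    exact card_pos.2 hne
  have hmain : (k - 1) * B.card ≤ G.edgeFinset.card * (A.card - 1) := by
    rcases Nat.lt_or_ge A.card 2 with h2 | h2
    · have hB0 : B.card = 0 := by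
        rw [card_eq_zero, hB, filter_eq_empty_iff]
        intro e he hv
        induction e using Sym2.ind with
        | _ a b =>
          have hab := card_le_one.1 (Nat.lt_succ_iff.1 h2) a (hv a (Sym2.mem_mk_left a b))
            b (hv b (Sym2.mem_mk_right a b))
          exact G.not_isDiag_of_mem_edgeFinset he (Sym2.mk_isDiag_iff.2 hab)
      rw [hB0, mul_zero]
      exact Nat.zero_le _
    · have h := hbal ((⊤ : G.Subgraph).induce A) (by simpa [Set.ncard_coe_finset] using h2)
      have hE : ((⊤ : G.Subgraph).induce (A : Set (Fin k))).edgeSet = B := by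
        ext e
        induction e using Sym2.ind with
        | _ a b =>
          simp only [SimpleGraph.Subgraph.mem_edgeSet, SimpleGraph.Subgraph.induce_adj, mem_coe,
            SimpleGraph.Subgraph.top_adj, hB, coe_filter, Set.mem_ofPred_eq,
            SimpleGraph.mem_edgeFinset, SimpleGraph.mem_edgeSet, Sym2.mem_iff,
            forall_eq_or_imp, forall_eq]
          tauto
      rw [hE, Set.ncard_coe_finset, SimpleGraph.Subgraph.induce_verts,
        Set.ncard_coe_finset] at h
      rwa [mul_comm]
  rw [hAcard]
  obtain ⟨a, ha⟩ := Nat.exists_eq_succ_of_ne_zero hApos.ne'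
  rw [ha, Nat.succ_eq_add_one, Nat.add_sub_cancel] at hmain
  rw [ha, Nat.succ_eq_add_one, mul_add, mul_one]
  exact Nat.add_le_add_right ((Nat.mul_le_mul_left _ hBcard).trans hmain) _

/-- A connected family of copies of a strongly balanced graph is at least as dense as `G`. -/
lemma StronglyBalanced.card_union_le (hk : 1 ≤ k) (hbal : StronglyBalanced G) {j : ℕ}
    (hj : 0 < j) (g : Fin j → Fin k ↪ Fin n)
    (hconn : ∀ T : Finset (Fin j), T.Nonempty → T ≠ univ →
      ∃ i ∈ T, ∃ i' ∉ T, ¬ Disjoint (copyVerts (g i)) (copyVerts (g i'))) :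
    G.edgeFinset.card * (univ.biUnion fun i => copyVerts (g i)).card
      ≤ (k - 1) * (univ.biUnion fun i => copyEdges G (g i)).card + G.edgeFinset.card := by
  classical
  let Q : Finset (Fin j) → Prop := fun T =>
    G.edgeFinset.card * (T.biUnion fun i => copyVerts (g i)).card
      ≤ (k - 1) * (T.biUnion fun i => copyEdges G (g i)).card + G.edgeFinset.card
  obtain ⟨m, rfl⟩ := Nat.exists_eq_succ_of_ne_zero (Nat.one_le_iff_ne_zero.1 hk)
  have hbase : Q {⟨0, hj⟩} := by
    simp only [Q, singleton_biUnion, card_copyVerts, card_copyEdges, Nat.succ_eq_add_one,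
      Nat.add_sub_cancel]
    exact le_of_eq (by ring)
  obtain ⟨T, hT, hmax⟩ := Finset.exists_max_image
    (univ.filter fun T : Finset (Fin j) => T.Nonempty ∧ Q T) Finset.card
    ⟨{⟨0, hj⟩}, by simpa using hbase⟩
  simp only [mem_filter, mem_univ, true_and] at hT hmax
  by_cases hTu : T = univ
  · exact hTu ▸ hT.2
  exfalso
  obtain ⟨i, hi, i', hi', hdis⟩ := hconn T hT.1 hTu
  have hlt : (insert i' T).card ≤ T.card := by
    refine hmax _ ⟨insert_nonempty _ _, ?_⟩
    have hTQ := hT.2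
    simp only [Q, biUnion_insert] at hTQ ⊢
    set W := T.biUnion fun i => copyVerts (g i)
    set F := T.biUnion fun i => copyEdges G (g i)
    have hne : (W ∩ copyVerts (g i')).Nonempty := by
      rw [Finset.not_disjoint_iff] at hdis
      obtain ⟨v, hv, hv'⟩ := hdis
      exact ⟨v, mem_inter.2 ⟨mem_biUnion.2 ⟨i, hi, hv⟩, hv'⟩⟩
    have hFW : ∀ e ∈ F, ∀ v ∈ e, v ∈ W := fun e he v hv => by
      obtain ⟨i, hi, he'⟩ := mem_biUnion.1 he
      exact mem_biUnion.2 ⟨i, hi, mem_copyVerts_of_mem_copyEdges he' hv⟩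
    have h1 := hbal.card_inter_le (g i') hFW hne
    have h2 := card_union_add_card_inter W (copyVerts (g i'))
    have h3 := card_union_add_card_inter F (copyEdges G (g i'))
    rw [card_copyVerts] at h2
    rw [card_copyEdges] at h3
    rw [union_comm (copyVerts _), union_comm (copyEdges _ _)]
    simp only [Nat.succ_eq_add_one, Nat.add_sub_cancel] at *
    have h2' := congrArg (G.edgeFinset.card * ·) h2
    have h3' := congrArg (m * ·) h3
    simp only [mul_add, mul_one] at h2' h3'
    have := mul_comm m G.edgeFinset.card
    linarith
  rw [card_insert_of_notMem hi'] at hlt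
  omega

end Copies

section Counting

lemma choose_add_le_pow (k r : ℕ) : (k + r).choose k ≤ (r + 1) ^ k := by
  induction k with
  | zero => simp
  | succ k ih =>
    have h := Nat.add_one_mul_choose_eq (k + r) k
    have h2 : k + r + 1 ≤ (r + 1) * (k + 1) := by
      nlinarith [Nat.zero_le (r * k)]
    rw [add_right_comm]
    refine Nat.le_of_mul_le_mul_right (c := k + 1) ?_ (Nat.succ_pos k)
    rw [← h, pow_succ, mul_comm (k + r + 1), mul_assoc]
    exact Nat.mul_le_mul ih h2

lemma two_mul_le_two_pow {j : ℕ} (hj : 2 ≤ j) : 2 * j ≤ 2 ^ j := by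
  induction j, hj using Nat.le_induction with
  | base => norm_num
  | succ m hm ih =>
    rw [pow_succ]
    omega

lemma two_mul_le_factorial_pow {j k : ℕ} (hj : 2 ≤ j) (hk : 2 ≤ k) :
    2 * j ≤ j.factorial ^ k := by
  have h1 : j ≤ j.factorial := Nat.self_le_factorial j
  calc 2 * j ≤ j.factorial * j.factorial := Nat.mul_le_mul (hj.trans h1) h1
    _ = j.factorial ^ 2 := (sq _).symm
    _ ≤ j.factorial ^ k := Nat.pow_le_pow_right (Nat.factorial_pos j) hk

lemma choose_pow_mul_pow_le {j k : ℕ} (hj : 2 ≤ j) (hk : 2 ≤ k) {ε : ℝ} (h0 : 0 ≤ ε)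
    (hε : ε ≤ Real.exp (-(4 * k)) / 2) (r : ℕ) :
    ((k + r).choose k : ℝ) ^ j * ε ^ r
      ≤ (j.factorial : ℝ) ^ k / (2 * j) * (1 / 2) ^ r := by
  have hjpos : (0 : ℝ) < 2 * j := by positivity
  rcases Nat.eq_zero_or_pos r with rfl | hr
  · simp only [add_zero, Nat.choose_self, Nat.cast_one, one_pow, pow_zero, mul_one]
    rw [le_div_iff₀ hjpos, one_mul]
    exact_mod_cast two_mul_le_factorial_pow hj hk
  · have h1 : ((k + r).choose k : ℝ) ≤ ((r : ℝ) + 1) ^ k := by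
      exact_mod_cast choose_add_le_pow k r
    have h2 : ((r : ℝ) + 1) ^ j ≤ j.factorial / 2 ^ j * Real.exp (2 * (r + 1)) := by
      have := Real.pow_div_factorial_le_exp (2 * ((r : ℝ) + 1)) (by positivity) j
      rw [div_le_iff₀ (by positivity), mul_pow] at this
      rw [div_mul_eq_mul_div, le_div_iff₀ (by positivity)]
      linarith
    have h3 : ((k + r).choose k : ℝ) ^ j
        ≤ (j.factorial : ℝ) ^ k / (2 * j) * Real.exp (2 * (r + 1)) ^ k := by
      calc ((k + r).choose k : ℝ) ^ j ≤ (((r : ℝ) + 1) ^ k) ^ j :=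
            pow_le_pow_left₀ (Nat.cast_nonneg _) h1 j
        _ = (((r : ℝ) + 1) ^ j) ^ k := by rw [← pow_mul, ← pow_mul, mul_comm]
        _ ≤ (j.factorial / 2 ^ j * Real.exp (2 * (r + 1))) ^ k :=
            pow_le_pow_left₀ (by positivity) h2 k
        _ = (j.factorial : ℝ) ^ k / (2 ^ j) ^ k * Real.exp (2 * (r + 1)) ^ k := by
            rw [mul_pow, div_pow]
        _ ≤ _ := by
            refine mul_le_mul_of_nonneg_right ?_ (by positivity)
            refine div_le_div_of_nonneg_left (by positivity) hjpos ?_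
            calc (2 * j : ℝ) ≤ 2 ^ j := by exact_mod_cast two_mul_le_two_pow hj
              _ ≤ (2 ^ j) ^ k := le_self_pow₀ (one_le_pow₀ one_le_two) (by omega)
    have h4 : Real.exp (2 * (r + 1)) ^ k ≤ Real.exp (4 * k) ^ r := by
      rw [← Real.exp_nat_mul, ← Real.exp_nat_mul, Real.exp_le_exp]
      have : (1 : ℝ) ≤ r := by exact_mod_cast hr
      have hk0 : (0 : ℝ) ≤ k := Nat.cast_nonneg k
      nlinarith
    calc ((k + r).choose k : ℝ) ^ j * ε ^ r
        ≤ ((j.factorial : ℝ) ^ k / (2 * j) * Real.exp (4 * k) ^ r)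
            * (Real.exp (-(4 * k)) / 2) ^ r := by
          refine mul_le_mul (h3.trans ?_) (pow_le_pow_left₀ h0 hε r) (by positivity)
            (by positivity)
          exact mul_le_mul_of_nonneg_left h4 (by positivity)
      _ = (j.factorial : ℝ) ^ k / (2 * j)
            * (Real.exp (4 * k) * Real.exp (-(4 * k)) / 2) ^ r := by
          rw [mul_assoc, ← mul_pow, mul_div_assoc]
      _ = _ := by rw [← Real.exp_add, add_neg_cancel, Real.exp_zero]

lemma sum_half_pow_sub_le (k N : ℕ) :
    ∑ b ∈ range N, (if k ≤ b then ((1 : ℝ) / 2) ^ (b - k) else 0) ≤ 2 := by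
  calc ∑ b ∈ range N, (if k ≤ b then ((1 : ℝ) / 2) ^ (b - k) else 0)
      ≤ ∑ b ∈ range (k + N), (if k ≤ b then ((1 : ℝ) / 2) ^ (b - k) else 0) := by
        refine sum_le_sum_of_subset_of_nonneg (range_mono (Nat.le_add_left N k)) ?_
        intro b _ _
        split_ifs <;> positivity
    _ = ∑ r ∈ range N, ((1 : ℝ) / 2) ^ r := by
        rw [sum_range_add, sum_eq_zero, zero_add]
        · simp
        · intro b hb
          rw [if_neg (not_le.2 (mem_range.1 hb))]
    _ ≤ 2 := sum_geometric_two_le N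

lemma pow_le_pow_mul_rpow_pow {c : ℝ} (hc : c ∈ Set.Ioo (0 : ℝ) 1) {k e b m : ℕ} (hk : 2 ≤ k)
    (hb : k ≤ b) (h : e * b ≤ (k - 1) * m + e) :
    c ^ m ≤ c ^ e * (c ^ ((e : ℝ) / ((k : ℝ) - 1))) ^ (b - k) := by
  have hk1 : (0 : ℝ) < (k : ℝ) - 1 := by
    have : (2 : ℝ) ≤ k := by exact_mod_cast hk
    linarith
  rw [← Real.rpow_natCast, ← Real.rpow_natCast c e, ← Real.rpow_mul_natCast hc.1.le,
    ← Real.rpow_add hc.1]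
  refine Real.rpow_le_rpow_of_exponent_ge hc.1 hc.2.le ?_
  rw [Nat.cast_sub hb, div_mul_eq_mul_div, ← le_sub_iff_add_le', div_le_iff₀ hk1]
  have h' : (e : ℝ) * b ≤ ((k : ℝ) - 1) * m + e := by
    have : ((k - 1 : ℕ) : ℝ) = (k : ℝ) - 1 := by
      rw [Nat.cast_sub (by omega), Nat.cast_one]
    rw [← this]
    exact_mod_cast h
  linarith

lemma card_copies_subset_le {k n j : ℕ} (V : Finset (Fin n)) :
    (univ.filter fun g : Fin j → Fin k ↪ Fin n => (univ.biUnion fun i => copyVerts (g i)) = V).card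
      ≤ (V.card.descFactorial k) ^ j := by
  classical
  have h1 : (univ.filter fun γ : Fin k ↪ Fin n => copyVerts γ ⊆ V).card
      ≤ V.card.descFactorial k := by
    have h := Fintype.card_embedding_eq (α := Fin k) (β := V)
    rw [Fintype.card_coe, Fintype.card_fin] at h
    rw [← h, ← Finset.card_univ]
    refine (card_le_card (t := univ.image fun γ : Fin k ↪ V =>
      γ.trans (Function.Embedding.subtype _)) ?_).trans card_image_le
    intro γ hγ
    have hmem : ∀ a, γ a ∈ V := fun a =>
      (mem_filter.1 hγ).2 (mem_map.2 ⟨a, mem_univ a, rfl⟩)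
    refine mem_image.2 ⟨⟨fun a => ⟨γ a, hmem a⟩, fun a b hab => ?_⟩, mem_univ _, ?_⟩
    · exact γ.injective (congrArg Subtype.val hab)
    · ext a
      rfl
  calc _ ≤ (Fintype.piFinset fun _ : Fin j =>
        univ.filter fun γ : Fin k ↪ Fin n => copyVerts γ ⊆ V).card := by
        refine card_le_card fun g hg => ?_
        rw [Fintype.mem_piFinset]
        intro i
        refine mem_filter.2 ⟨mem_univ _, ?_⟩
        rw [← (mem_filter.1 hg).2]
        exact subset_biUnion_of_mem (fun i => copyVerts (g i)) (mem_univ i)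
    _ = _ := Fintype.card_piFinset_const _ _
    _ ≤ _ := Nat.pow_le_pow_left h1 j

lemma choose_mul_descFactorial_pow_le {k n j : ℕ} (hj : 1 ≤ j) (r : ℕ) {q : ℝ} (hq : 0 ≤ q) :
    (n.choose (k + r) : ℝ) * (((k + r).descFactorial k : ℝ) ^ j * q ^ r)
      ≤ (n : ℝ) ^ k * (k.factorial : ℝ) ^ (j - 1)
        * (((k + r).choose k : ℝ) ^ j * (n * q) ^ r) := by
  have h1 : (n.choose (k + r) : ℝ) ≤ (n : ℝ) ^ (k + r) / k.factorial :=
    (Nat.choose_le_pow_div _ _).trans (div_le_div_of_nonneg_left (by positivity) (by positivity)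
      (by exact_mod_cast Nat.factorial_le (Nat.le_add_right k r)))
  refine (mul_le_mul_of_nonneg_right h1 (by positivity)).trans (le_of_eq ?_)
  obtain ⟨i, rfl⟩ := Nat.exists_eq_succ_of_ne_zero (Nat.one_le_iff_ne_zero.1 hj)
  rw [Nat.descFactorial_eq_factorial_mul_choose, Nat.succ_eq_add_one, Nat.add_sub_cancel]
  have : (k.factorial : ℝ) ≠ 0 := by positivity
  push_cast
  field_simp
  ring

lemma sum_copies_weight_le {k n j : ℕ} (hk : 2 ≤ k) (hj : 2 ≤ j) {q : ℝ} (hq0 : 0 ≤ q)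
    (hsmall : (n : ℝ) * q ≤ Real.exp (-(4 * k)) / 2) :
    ∑ g : Fin j → Fin k ↪ Fin n, q ^ ((univ.biUnion fun i => copyVerts (g i)).card - k)
      ≤ (n : ℝ) ^ k * (k.factorial : ℝ) ^ (j - 1) * ((j.factorial : ℝ) ^ k / j) := by
  set w : ℕ → ℝ := fun b => if k ≤ b then q ^ (b - k) else 0 with hw
  have hw0 : ∀ b, 0 ≤ w b := fun b => by
    simp only [hw]
    split_ifs <;> positivity
  set verts : (Fin j → Fin k ↪ Fin n) → Finset (Fin n) :=
    fun g => univ.biUnion fun i => copyVerts (g i)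
  have hkverts : ∀ g, k ≤ (verts g).card := fun g => by
    have h0 := card_le_card (subset_biUnion_of_mem (fun i => copyVerts (g i))
      (mem_univ (⟨0, by omega⟩ : Fin j)))
    rwa [card_copyVerts] at h0
  calc ∑ g : Fin j → Fin k ↪ Fin n, q ^ ((verts g).card - k)
      = ∑ g : Fin j → Fin k ↪ Fin n, w (verts g).card :=
        sum_congr rfl fun g _ => by simp only [hw, if_pos (hkverts g)]
    _ = ∑ V : Finset (Fin n), ∑ g : Fin j → Fin k ↪ Fin n with verts g = V,
          w (verts g).card := (Finset.sum_fiberwise _ _ _).symm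
    _ ≤ ∑ V : Finset (Fin n), (V.card.descFactorial k : ℝ) ^ j * w V.card := by
        refine sum_le_sum fun V _ => ?_
        rw [sum_congr rfl fun g hg => by rw [(mem_filter.1 hg).2], sum_const, nsmul_eq_mul]
        refine mul_le_mul_of_nonneg_right ?_ (hw0 _)
        exact_mod_cast card_copies_subset_le V
    _ = ∑ b ∈ range (n + 1), (n.choose b : ℝ) * ((b.descFactorial k : ℝ) ^ j * w b) := by
        have := Finset.sum_powerset_apply_card (x := (univ : Finset (Fin n)))
          fun b => (b.descFactorial k : ℝ) ^ j * w b
        rw [Finset.powerset_univ, Finset.card_univ, Fintype.card_fin] at this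
        rw [this]
        simp only [nsmul_eq_mul]
    _ ≤ ∑ b ∈ range (n + 1), (n : ℝ) ^ k * (k.factorial : ℝ) ^ (j - 1)
          * ((j.factorial : ℝ) ^ k / (2 * j))
          * (if k ≤ b then ((1 : ℝ) / 2) ^ (b - k) else 0) := by
        refine sum_le_sum fun b _ => ?_
        by_cases hb : k ≤ b
        · obtain ⟨r, rfl⟩ := Nat.exists_eq_add_of_le hb
          simp only [hw, if_pos hb, Nat.add_sub_cancel_left]
          refine (choose_mul_descFactorial_pow_le (by omega) r hq0).trans ?_
          rw [mul_assoc _ (_ / _)]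
          exact mul_le_mul_of_nonneg_left
            (choose_pow_mul_pow_le hj hk (by positivity) hsmall r) (by positivity)
        · simp [hw, if_neg hb]
    _ ≤ (n : ℝ) ^ k * (k.factorial : ℝ) ^ (j - 1)
          * ((j.factorial : ℝ) ^ k / (2 * j)) * 2 := by
        rw [← Finset.mul_sum]
        exact mul_le_mul_of_nonneg_left (sum_half_pow_sub_le k (n + 1)) (by positivity)
    _ = _ := by
        have : (j : ℝ) ≠ 0 := by
          have : j ≠ 0 := by omega
          exact_mod_cast this
        field_simp

lemma prod_lt_adj {k : ℕ} (G : SimpleGraph (Fin k)) [DecidableRel G.Adj] (f : Sym2 (Fin k) → ℝ) :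
    ∏ q ∈ (Finset.univ : Finset (Fin k × Fin k)).filter (fun q => q.1 < q.2 ∧ G.Adj q.1 q.2),
      f s(q.1, q.2) = ∏ e ∈ G.edgeFinset, f e := by
  rw [← prod_ordPairs fun e he => G.not_isDiag_of_mem_edgeFinset he]
  symm
  refine Finset.prod_bij (fun q _ => q.1) ?_ ?_ ?_ ?_
  · intro q hq
    have := (mem_filter.1 hq).2
    rw [SimpleGraph.mem_edgeFinset, SimpleGraph.mem_edgeSet] at this
    exact mem_filter.2 ⟨mem_univ _, q.2, this⟩
  · intro q _ q' _ h
    exact Subtype.ext h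
  · intro q hq
    obtain ⟨-, h1, h2⟩ := mem_filter.1 hq
    exact ⟨⟨q, h1⟩, mem_filter.2 ⟨mem_univ _, by simpa using h2⟩, rfl⟩
  · intro q _
    rfl

lemma NG_eq_sum_copies {d k n : ℕ} {Ω : Type*} (G : SimpleGraph (Fin k)) [DecidableRel G.Adj]
    {H : (Fin d → ℝ) → (Fin d → ℝ) → ℝ} (hHsym : ∀ x y, H x y = H y x) (a : ℕ)
    (X : Fin n → Ω → (Fin d → ℝ)) {Y : Fin n → Fin n → Ω → ℝ}
    (hYsym : ∀ a b, Y a b = Y b a) :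
    NG G H c a X Y = fun ω =>
      (a : ℝ)⁻¹ * ∑ γ : Fin k ↪ Fin n, ∏ e ∈ copyEdges G γ, edgeInd H c X Y e ω := by
  ext ω
  rw [NG]
  congr 1
  symm
  refine Finset.sum_bij (fun γ _ => γ) ?_ ?_ ?_ ?_
  · intro γ _
    exact mem_filter.2 ⟨mem_univ _, γ.injective⟩
  · intro γ _ γ' _ h
    exact DFunLike.coe_injective h
  · intro β hβ
    exact ⟨⟨β, (mem_filter.1 hβ).2⟩, mem_univ _, rfl⟩
  · intro γ _
    rw [copyEdges, prod_image fun e _ e' _ h => Sym2.map.injective γ.injective h,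
      ← prod_lt_adj G]
    exact prod_congr rfl fun q _ => edgeInd_mk hHsym hYsym _ _ ω

variable {k n : ℕ} {G : SimpleGraph (Fin k)} [DecidableRel G.Adj]
  {Ω : Type*} [MeasurableSpace Ω] {P : Measure Ω} [IsProbabilityMeasure P]
  {c : ℝ} {J : Sym2 (Fin n) → Ω → ℝ}

lemma EdgeModel.abs_jointCumulant_copies_le (hJ : EdgeModel P c J) (hc : c ∈ Set.Ioo (0 : ℝ) 1)
    (hbal : StronglyBalanced G) (hk : 2 ≤ k) {j : ℕ} (hj : 2 ≤ j) (g : Fin j → Fin k ↪ Fin n) :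
    |jointCumulant P (fun i ω => ∏ e ∈ copyEdges G (g i), J e ω)|
      ≤ (j : ℝ) ^ j * (c ^ G.edgeFinset.card *
          (c ^ ((G.edgeFinset.card : ℝ) / ((k : ℝ) - 1))) ^
            ((univ.biUnion fun i => copyVerts (g i)).card - k)) := by
  have hE : ∀ i, ∀ e ∈ copyEdges G (g i), ¬ e.IsDiag := fun i e he =>
    not_isDiag_of_mem_copyEdges he
  by_cases hconn : ∀ T : Finset (Fin j), T.Nonempty → T ≠ univ →
      ∃ i ∈ T, ∃ i' ∉ T, ¬ Disjoint (copyVerts (g i)) (copyVerts (g i'))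
  · refine (hJ.abs_jointCumulant_le ⟨hc.1.le, hc.2.le⟩ hE).trans
      (mul_le_mul_of_nonneg_left ?_ (by positivity))
    refine pow_le_pow_mul_rpow_pow hc hk ?_
      (hbal.card_union_le (by omega) (by omega) g hconn)
    have h0 := card_le_card (subset_biUnion_of_mem (fun i => copyVerts (g i))
      (mem_univ (⟨0, by omega⟩ : Fin j)))
    rwa [card_copyVerts] at h0
  · push Not at hconn
    obtain ⟨T, hT, hT', hdisj⟩ := hconn
    rw [hJ.jointCumulant_eq_zero hE
      (fun i e he v hv => mem_copyVerts_of_mem_copyEdges he hv) hT hT' hdisj, abs_zero]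
    have := hc.1.le
    positivity

lemma EdgeModel.abs_cum_le (hJ : EdgeModel P c J) (hc : c ∈ Set.Ioo (0 : ℝ) 1)
    (hbal : StronglyBalanced G) (hk : 2 ≤ k) {j : ℕ} (hj : 2 ≤ j)
    (hsmall : (n : ℝ) * c ^ ((G.edgeFinset.card : ℝ) / ((k : ℝ) - 1))
      ≤ Real.exp (-(4 * k)) / 2) (a : ℕ) :
    |cum P j (fun ω => (a : ℝ)⁻¹ * ∑ γ : Fin k ↪ Fin n, ∏ e ∈ copyEdges G γ, J e ω)|
      ≤ (j : ℝ) ^ (j - 1) * (j.factorial : ℝ) ^ k * (k.factorial : ℝ) ^ (j - 1)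
          / (a : ℝ) ^ j * (n : ℝ) ^ k * c ^ G.edgeFinset.card := by
  set q : ℝ := c ^ ((G.edgeFinset.card : ℝ) / ((k : ℝ) - 1))
  have hq0 : 0 ≤ q := Real.rpow_nonneg hc.1.le _
  have hc0 := hc.1.le
  have hInt : ∀ (g : Fin j → Fin k ↪ Fin n) (b : Finset (Fin j)),
      Integrable (fun ω => ∏ i ∈ b, ∏ e ∈ copyEdges G (g i), J e ω) P := fun g b =>
    hJ.integrable (E := fun i => copyEdges G (g i))
      (fun i e he => not_isDiag_of_mem_copyEdges he) b
  have hcum := cum_const_mul_sum (P := P) (a : ℝ)⁻¹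
    (fun (γ : Fin k ↪ Fin n) ω => ∏ e ∈ copyEdges G γ, J e ω) hInt
  rw [hcum, abs_mul, abs_pow, abs_inv, Nat.abs_cast]
  have hsum : |∑ g : Fin j → Fin k ↪ Fin n,
      jointCumulant P (fun i ω => ∏ e ∈ copyEdges G (g i), J e ω)|
      ≤ (j : ℝ) ^ j * c ^ G.edgeFinset.card *
        ((n : ℝ) ^ k * (k.factorial : ℝ) ^ (j - 1) * ((j.factorial : ℝ) ^ k / j)) := by
    refine ((abs_sum_le_sum_abs _ _).trans (sum_le_sum fun g _ =>
      hJ.abs_jointCumulant_copies_le hc hbal hk hj g)).trans ?_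
    refine le_trans (le_of_eq ?_) (mul_le_mul_of_nonneg_left
      (sum_copies_weight_le hk hj hq0 hsmall) (by positivity))
    rw [Finset.mul_sum]
    exact sum_congr rfl fun g _ => (mul_assoc _ _ _).symm
  have hj0 : (j : ℝ) ≠ 0 := by
    have : j ≠ 0 := by omega
    exact_mod_cast this
  have hpow : (j : ℝ) ^ j = (j : ℝ) ^ (j - 1) * j := (pow_sub_one_mul (by omega) _).symm
  refine (mul_le_mul_of_nonneg_left hsum (by positivity)).trans (le_of_eq ?_)
  rw [hpow, inv_pow]
  generalize (j : ℝ) ^ (j - 1) = x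
  field_simp

end Counting

/-- Cumulant growth rate for the counts of strongly balanced connected graphs in the
sparse regime `p_n ≪ n^{−(v(G)−1)/e(G)}`: for `n` large enough and all `j ≥ 2`,
`|κ_j(N_G)| ≤ j^{j−1} (j!)^{v(G)} (v(G)!)^{j−1} a(G)^{−j} n^{v(G)} p_n^{e(G)}`. -/
theorem cumulant_growth_sparse
    {d k : ℕ} (hk : 2 ≤ k)
    (G : SimpleGraph (Fin k)) [DecidableRel G.Adj] (hGconn : G.Connected)
    (μ : Measure (Fin d → ℝ)) [IsProbabilityMeasure μ] (hμ : ∀ x, μ {x} = 0)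
    (H : (Fin d → ℝ) → (Fin d → ℝ) → ℝ)
    (hHm : Measurable fun z : (Fin d → ℝ) × (Fin d → ℝ) => H z.1 z.2)
    (hHsym : ∀ x y, H x y = H y x) (hH01 : ∀ x y, H x y ∈ Set.Icc (0 : ℝ) 1)
    (p : ℕ → ℝ) (hp : ∀ n, p n ∈ Set.Ioo (0 : ℝ) 1)
    (Ω : ℕ → Type) [∀ n, MeasurableSpace (Ω n)]
    (P : ∀ n, Measure (Ω n)) [∀ n, IsProbabilityMeasure (P n)]
    (X : ∀ n, Fin n → Ω n → (Fin d → ℝ)) (Y : ∀ n, Fin n → Fin n → Ω n → ℝ)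
    (hYsym : ∀ n a b, Y n a b = Y n b a)
    (hlaw : ∀ n, Measure.map (fun ω => ((fun i => X n i ω),
        (fun q : {q : Fin n × Fin n // q.1 < q.2} => Y n q.1.1 q.1.2 ω))) (P n)
      = (Measure.pi fun _ => μ).prod
          (Measure.pi fun _ => (volume.restrict (Set.Icc (0 : ℝ) 1))))
    (hbal : StronglyBalanced G)
    (hgrow : Filter.Tendsto
      (fun n : ℕ => (n : ℝ) * p n ^ ((G.edgeFinset.card : ℝ) / ((k : ℝ) - 1)))
      Filter.atTop (nhds 0)) :
    ∃ n₀ : ℕ, ∀ n, n₀ ≤ n → ∀ j, 2 ≤ j →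
      |cum (P n) j (NG G H (p n) (autCard G) (X n) (Y n))|
        ≤ (j : ℝ) ^ (j - 1) * (j.factorial : ℝ) ^ k * (k.factorial : ℝ) ^ (j - 1)
            / (autCard G : ℝ) ^ j
            * (n : ℝ) ^ k * p n ^ G.edgeFinset.card := by
  have hev := hgrow.eventually
    (ge_mem_nhds (show (0 : ℝ) < Real.exp (-(4 * k)) / 2 by positivity))
  obtain ⟨n₀, hn₀⟩ := Filter.eventually_atTop.1 hev
  refine ⟨n₀, fun n hn j hj => ?_⟩
  rw [NG_eq_sum_copies G hHsym _ _ (hYsym n)]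
  have hpn := hp n
  exact (edgeModel_edgeInd hHm hHsym hH01 ⟨hpn.1.le, hpn.2.le⟩ (hYsym n) (hlaw n)).abs_cum_le
    hpn hbal hk hj (hn₀ n hn) _
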